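/- Let Σ be a finite alphabet with |Σ| = s ≥ 2 and W₀ a word over Σ of length L₀ ≥ 1 with no proper nonempty prefix equal to a suffix. Let b_n be the number of words of length n over Σ avoiding W₀ as a factor. Then limsup_{n→∞} b_n^{1/n} ≤ s - 1/s^{L₀-1}. -/

import Mathlib

open Filter

lemma tail_avoids {A : Type*} (a : A) (t v : List A)
    (hpre : ∀ k, 1 ≤ k → k ≤ t.length → (a :: t).take k ≠ (a :: t).drop (t.length + 1 - k))
    (hv : ¬ (a :: t) <:+: v) : ¬ (a :: t) <:+: t ++ v := by
  rintro ⟨p, q, h⟩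
  rw [List.append_assoc, List.append_eq_append_iff] at h
  rcases h with ⟨c, hc, h⟩ | ⟨c, hc, h⟩
  · rcases Nat.eq_zero_or_pos c.length with h0 | h0
    · have : c = [] := List.length_eq_zero_iff.mp h0
      subst this
      exact hv ⟨[], q, by simpa using h⟩
    · have hl : t.length = p.length + c.length := by rw [hc]; simp
      apply hpre c.length h0 (by omega)
      have h1 : (a :: t).take c.length = c := by
        have := congrArg (List.take c.length) h
        rw [List.take_append_of_le_length (by simp; omega)] at this
        simpa using this
      have h2 : (a :: t).drop (t.length + 1 - c.length) = c := by
        have e : t.length + 1 - c.length = (a :: p).length := by simp; omega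
        have e2 : a :: t = (a :: p) ++ c := by rw [hc]; simp
        rw [e, e2, List.drop_left]
      rw [h1, h2]
  · exact hv ⟨c, q, by rw [h]; simp⟩

lemma avoid_ratio {A : Type*} [Fintype A] [DecidableEq A]
    (a : A) (t : List A)
    (hpre : ∀ k, 1 ≤ k → k ≤ t.length → (a :: t).take k ≠ (a :: t).drop (t.length + 1 - k))
    (b : ℕ → ℕ)
    (hbdef : ∀ n, b n = Finset.card
      (Finset.univ.filter (fun w : Fin n → A => ¬ (a :: t) <:+: List.ofFn w))) (m : ℕ) :
    b (m + t.length + 1) + b m ≤ Fintype.card A * b (m + t.length) ∧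
    b (m + t.length) ≤ Fintype.card A ^ t.length * b m := by
  classical
  let F : ℕ → Finset (List A) := fun n =>
    (Finset.univ.filter (fun w : Fin n → A => ¬ (a :: t) <:+: List.ofFn w)).image List.ofFn
  have hF : ∀ n, (F n).card = b n := fun n => by
    rw [hbdef]; exact Finset.card_image_of_injective _ List.ofFn_injective
  have mem : ∀ n l, l ∈ F n ↔ l.length = n ∧ ¬ (a :: t) <:+: l := by
    intro n l
    simp only [F, Finset.mem_image, Finset.mem_filter, Finset.mem_univ, true_and]
    constructor
    · rintro ⟨w, hw, rfl⟩; exact ⟨by simp, hw⟩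
    · rintro ⟨rfl, hl⟩; exact ⟨l.get, by simpa using hl, by simp⟩
  constructor
  · have hd : Disjoint (F (m + t.length + 1)) ((F m).image (fun v => (a :: t) ++ v)) := by
      rw [Finset.disjoint_left]
      intro l hl hl'
      obtain ⟨v, -, rfl⟩ := Finset.mem_image.mp hl'
      exact ((mem _ _).mp hl).2 ⟨[], v, rfl⟩
    have hsub : F (m + t.length + 1) ∪ (F m).image (fun v => (a :: t) ++ v) ⊆
        ((Finset.univ : Finset A) ×ˢ F (m + t.length)).image (fun x => x.1 :: x.2) := by
      intro l hl
      rw [Finset.mem_image]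
      rcases Finset.mem_union.mp hl with hl | hl
      · rw [mem] at hl
        cases l with
        | nil => simp at hl
        | cons x u =>
          refine ⟨(x, u), ?_, rfl⟩
          simp only [Finset.mem_product, Finset.mem_univ, true_and, mem]
          exact ⟨by simpa using hl.1, fun h => hl.2 (h.trans (List.suffix_cons x u).isInfix)⟩
      · obtain ⟨v, hv, rfl⟩ := Finset.mem_image.mp hl
        rw [mem] at hv
        refine ⟨(a, t ++ v), ?_, rfl⟩
        simp only [Finset.mem_product, Finset.mem_univ, true_and, mem]
        exact ⟨by simp [hv.1, add_comm], tail_avoids a t v hpre hv.2⟩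
    have h1 := (Finset.card_le_card hsub).trans Finset.card_image_le
    rw [Finset.card_union_of_disjoint hd,
      Finset.card_image_of_injective _ (List.append_right_injective (a :: t)),
      Finset.card_product, hF, hF, hF, Finset.card_univ] at h1
    exact h1
  · have hsub : F (m + t.length) ⊆
        ((Finset.univ : Finset (Fin t.length → A)) ×ˢ F m).image
          (fun x => List.ofFn x.1 ++ x.2) := by
      intro l hl
      rw [mem] at hl
      rw [Finset.mem_image]
      have hlt : (l.take t.length).length = t.length := by simp; omega
      refine ⟨(fun i => (l.take t.length).get (i.cast hlt.symm), l.drop t.length), ?_, ?_⟩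
      · simp only [Finset.mem_product, Finset.mem_univ, true_and, mem]
        exact ⟨by simp; omega, fun h => hl.2 (h.trans (List.drop_suffix _ _).isInfix)⟩
      · have : List.ofFn (fun i : Fin t.length => (l.take t.length).get (i.cast hlt.symm))
            = l.take t.length := by
          apply List.ext_getElem
          · simp; omega
          · intro i h1 h2; simp
        simp only [this, List.take_append_drop]
    have h1 := (Finset.card_le_card hsub).trans Finset.card_image_le
    rw [Finset.card_product, hF, hF, Finset.card_univ, Fintype.card_fun, Fintype.card_fin] at h1
    exact h1

theorem stmt_12 {A : Type*} [Fintype A] [DecidableEq A]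
    (s : ℕ) (hs : Fintype.card A = s) (hs2 : 2 ≤ s)
    (w0 : List A) (L₀ : ℕ) (hlen : w0.length = L₀) (hL₀ : 1 ≤ L₀)
    (hpre : ∀ k, 1 ≤ k → k ≤ L₀ - 1 → w0.take k ≠ w0.drop (L₀ - k))
    (b : ℕ → ℕ)
    (hbdef : ∀ n, b n = Finset.card
      (Finset.univ.filter (fun w : Fin n → A => ¬ w0 <:+: List.ofFn w))) :
    limsup (fun n => ((b n : ℝ)) ^ ((n : ℝ)⁻¹)) atTop ≤ (s : ℝ) - 1 / (s : ℝ) ^ (L₀ - 1) := by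
  cases w0 with
  | nil => simp at hlen; omega
  | cons a t =>
  subst hlen
  simp only [List.length_cons, Nat.add_sub_cancel] at hpre ⊢
  have key := avoid_ratio a t hpre b hbdef
  rw [hs] at key
  have hsR : (2 : ℝ) ≤ s := by exact_mod_cast hs2
  have hP : (1 : ℝ) ≤ (s : ℝ) ^ t.length := one_le_pow₀ (by linarith)
  set r : ℝ := (s : ℝ) - 1 / (s : ℝ) ^ t.length with hr
  have hr0 : 0 < r := by
    have : 1 / (s : ℝ) ^ t.length ≤ 1 := by rw [div_le_one (by linarith)]; exact hP
    linarith
  have step : ∀ m, (b (m + t.length + 1) : ℝ) ≤ r * b (m + t.length) := by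
    intro m
    obtain ⟨h1, h2⟩ := key m
    have h1' : (b (m + t.length + 1) : ℝ) + b m ≤ s * b (m + t.length) := by exact_mod_cast h1
    have h2' : (b (m + t.length) : ℝ) ≤ s ^ t.length * b m := by exact_mod_cast h2
    have h3 : 1 / (s : ℝ) ^ t.length * b (m + t.length) ≤ b m := by
      rw [one_div_mul_eq_div, div_le_iff₀ (by linarith)]; linarith
    rw [hr, sub_mul]; linarith
  set C : ℝ := (b t.length + 1) / r ^ t.length with hC
  have hC0 : 0 < C := by positivity
  have bound : ∀ m, (b (m + t.length) : ℝ) ≤ C * r ^ (m + t.length) := by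
    intro m
    induction m with
    | zero =>
      rw [hC, Nat.zero_add, div_mul_cancel₀ _ (by positivity)]; linarith
    | succ k ih =>
      rw [show k + 1 + t.length = k + t.length + 1 by ring]
      calc _ ≤ r * b (k + t.length) := step k
        _ ≤ r * (C * r ^ (k + t.length)) := by gcongr
        _ = _ := by ring
  have hlim : Tendsto (fun n : ℕ => C ^ ((n : ℝ)⁻¹) * r) atTop (nhds r) := by
    have h1 : Tendsto (fun n : ℕ => C ^ ((n : ℝ)⁻¹)) atTop (nhds (C ^ (0 : ℝ))) :=
      (tendsto_const_nhds (x := C)).rpow (tendsto_inv_atTop_nhds_zero_nat (𝕜 := ℝ)) (Or.inl hC0.ne')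
    simpa using h1.mul_const r
  rw [← hlim.limsup_eq]
  apply limsup_le_limsup
  · filter_upwards [eventually_ge_atTop (t.length + 1)] with n hn
    obtain ⟨m, rfl⟩ : ∃ m, n = m + t.length := ⟨n - t.length, by omega⟩
    have hn0 : m + t.length ≠ 0 := by omega
    calc _ ≤ (C * r ^ (m + t.length)) ^ (((m + t.length : ℕ) : ℝ)⁻¹) :=
          Real.rpow_le_rpow (by positivity) (bound m) (by positivity)
      _ = _ := by
          rw [Real.mul_rpow hC0.le (by positivity), Real.pow_rpow_inv_natCast hr0.le hn0]
  · exact isCoboundedUnder_le_of_le atTop (x := 0) (fun n => by positivity)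
  · exact hlim.isBoundedUnder_le
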